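/- Let β ∈ {1,2,4} and n ≥ 1 an integer with βn > 4, and set b := 3βn/2 + 2 − β. Then the third cumulant (equivalently, third central moment) of the Wigner delay time satisfies E[(τ_W − E[τ_W])³] = 96 / ((n+1)(n+2)(nβ − 2)(nβ − 4)), where E denotes expectation with respect to the density (1/Z)∏_{j=1}^n τ_j^{−b} e^{−βn/(2τ_j)} ∏_{1≤j<k≤n}|τ_k−τ_j|^β on (0,∞)^n and τ_W := (1/n)∑_{j=1}^n τ_j. -/

import Mathlib

open MeasureTheory Finset

/-- The β-deformed Vandermonde interaction factor `∏_{j<k} |τ_k - τ_j|^β`. -/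
noncomputable def vand (β : ℝ) {n : ℕ} (T : Fin n → ℝ) : ℝ :=
  ∏ j, ∏ k ∈ Finset.Ioi j, |T k - T j| ^ β

/-- The (unnormalized) joint density `∏_j τ_j^{-b} e^{-βn/(2τ_j)} ∏_{j<k}|τ_k-τ_j|^β`
of the proper delay times. -/
noncomputable def wdW (β b : ℝ) (n : ℕ) (τ : Fin n → ℝ) : ℝ :=
  (∏ j, τ j ^ (-b) * Real.exp (-(β * n / (2 * τ j)))) * vand β τ

/-- Expectation of an observable with respect to the proper delay time density. -/
noncomputable def wdE (β b : ℝ) (n : ℕ) (f : (Fin n → ℝ) → ℝ) : ℝ :=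
  (∫ τ in Set.univ.pi (fun _ : Fin n => Set.Ioi (0 : ℝ)), f τ * wdW β b n τ) /
    ∫ τ in Set.univ.pi (fun _ : Fin n => Set.Ioi (0 : ℝ)), wdW β b n τ

open Filter Topology

section OneVariable

theorem exists_rpow_neg_mul_exp_neg_div_le (b : ℝ) {c : ℝ} (hc : 0 < c) :
    ∃ C : ℝ, 0 < C ∧ ∀ t : ℝ, 0 < t → t ≤ 1 → t ^ (-b) * Real.exp (-(c / t)) ≤ C * t := by
  obtain ⟨k, hk⟩ := exists_nat_ge (b + 1)
  have hfac : (0 : ℝ) < k.factorial := by positivity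
  refine ⟨k.factorial / c ^ k, by positivity, fun t ht ht1 => ?_⟩
  have h1 := Real.pow_div_factorial_le_exp (c / t) (by positivity) k
  have h2 : Real.exp (-(c / t)) ≤ k.factorial / c ^ k * t ^ (k : ℝ) := by
    rw [Real.exp_neg, Real.rpow_natCast]
    calc (Real.exp (c / t))⁻¹ ≤ ((c / t) ^ k / k.factorial)⁻¹ :=
          inv_anti₀ (by positivity) h1
      _ = _ := by rw [div_pow]; field_simp
  calc t ^ (-b) * Real.exp (-(c / t))
      ≤ t ^ (-b) * (k.factorial / c ^ k * t ^ (k : ℝ)) := by gcongr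
    _ = k.factorial / c ^ k * t ^ (-b + k) := by rw [Real.rpow_add ht]; ring
    _ ≤ k.factorial / c ^ k * t ^ (1 : ℝ) := by
        gcongr ?_ * ?_
        exact Real.rpow_le_rpow_of_exponent_ge ht ht1 (by linarith)
    _ = _ := by rw [Real.rpow_one]

theorem rpow_neg_mul_exp_neg_div_mul_rpow_le {a c t : ℝ} (b : ℝ) (ha : 0 ≤ a) (hc : 0 < c)
    (ht : 1 ≤ t) :
    t ^ (-b) * Real.exp (-(c / t)) * (1 + t) ^ a ≤ 2 ^ a * t ^ (a - b) := by
  have ht0 : 0 < t := by linarith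
  have h1 : Real.exp (-(c / t)) ≤ 1 := Real.exp_le_one_iff.2 (by
    have : 0 < c / t := by positivity
    linarith)
  have h2 : (1 + t) ^ a ≤ (2 * t) ^ a := Real.rpow_le_rpow (by linarith) (by linarith) ha
  calc t ^ (-b) * Real.exp (-(c / t)) * (1 + t) ^ a ≤ t ^ (-b) * 1 * (2 * t) ^ a := by gcongr
    _ = 2 ^ a * (t ^ (-b) * t ^ a) := by rw [Real.mul_rpow (by norm_num) ht0.le]; ring
    _ = _ := by rw [← Real.rpow_add ht0]; ring_nf

theorem integrableOn_rpow_neg_mul_exp_neg_div_mul_rpow {a b c : ℝ} (ha : 0 ≤ a) (hc : 0 < c)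
    (hab : a - b < -1) :
    IntegrableOn (fun t : ℝ => t ^ (-b) * Real.exp (-(c / t)) * (1 + t) ^ a) (Set.Ioi 0) := by
  obtain ⟨C, hC, hbound⟩ := exists_rpow_neg_mul_exp_neg_div_le b hc
  have hmeas : Measurable (fun t : ℝ => t ^ (-b) * Real.exp (-(c / t)) * (1 + t) ^ a) := by
    fun_prop
  rw [← Set.Ioc_union_Ioi_eq_Ioi (zero_le_one (α := ℝ))]
  refine IntegrableOn.union ?_ ?_
  · refine Measure.integrableOn_of_bounded (M := C * 2 ^ a) (by simp) hmeas.aestronglyMeasurable ?_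
    refine (ae_restrict_iff' measurableSet_Ioc).2 (ae_of_all _ fun t ht => ?_)
    have ht0 : 0 < t := ht.1
    rw [Real.norm_of_nonneg (by positivity)]
    have h1 := hbound t ht.1 ht.2
    gcongr
    · nlinarith [ht.2]
    · linarith [ht.2]
  · refine Integrable.mono' ((integrableOn_Ioi_rpow_of_lt hab one_pos).const_mul (2 ^ a))
      hmeas.aestronglyMeasurable ?_
    refine (ae_restrict_iff' measurableSet_Ioi).2 (ae_of_all _ fun t ht => ?_)
    have ht1 : (1 : ℝ) < t := ht
    rw [Real.norm_of_nonneg (by positivity)]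
    exact rpow_neg_mul_exp_neg_div_mul_rpow_le b ha hc ht1.le

theorem hasDerivAt_abs_sub_rpow {t y : ℝ} (β : ℝ) (h : t ≠ y) :
    HasDerivAt (fun t => |t - y| ^ β) (|t - y| ^ β * (β * (t - y)⁻¹)) t := by
  have h0 : t - y ≠ 0 := sub_ne_zero.2 h
  have h1 : HasDerivAt (fun t => |t - y|) (SignType.sign (t - y) : ℝ) t :=
    (((hasDerivAt_abs h0).comp t ((hasDerivAt_id t).sub_const y)).congr_deriv (mul_one _) :)
  refine (h1.rpow_const (p := β) (Or.inl (abs_ne_zero.2 h0))).congr_deriv ?_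
  rw [Real.rpow_sub_one (abs_ne_zero.2 h0)]
  rcases lt_or_gt_of_ne h0 with h2 | h2
  · rw [sign_neg h2, abs_of_neg h2]
    simp only [SignType.coe_neg_one]
    field_simp
  · rw [sign_pos h2, abs_of_pos h2]
    simp only [SignType.coe_one]
    field_simp

theorem abs_sub_rpow_le {β s t : ℝ} (hβ : 0 ≤ β) (ht : 0 ≤ t) :
    |t - s| ^ β ≤ (1 + t) ^ β * (1 + |s|) ^ β := by
  rw [← Real.mul_rpow (by positivity) (by positivity)]
  refine Real.rpow_le_rpow (abs_nonneg _) ?_ hβ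
  have := abs_sub t s
  rw [abs_of_nonneg ht] at this
  nlinarith [abs_nonneg s]

/-- The density of one proper delay time given the others, times the observable
`t ^ m * (t + s) ^ r`. -/
noncomputable def sliceFun (β b c : ℝ) (m r : ℕ) {N : ℕ} (y : Fin N → ℝ) (s t : ℝ) : ℝ :=
  t ^ m * (t + s) ^ r * (t ^ (-b) * Real.exp (-(c / t)) * ∏ k, |t - y k| ^ β)

variable {β b c : ℝ} {m r N : ℕ}

theorem hasDerivAt_sliceFun (y : Fin N → ℝ) (s : ℝ) {t : ℝ} (ht : 0 < t) (hy : ∀ k, t ≠ y k) :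
    HasDerivAt (sliceFun β b c m r y s)
      ((m * t ^ (m - 1) * (t + s) ^ r + r * t ^ m * (t + s) ^ (r - 1)
        + t ^ m * (t + s) ^ r * (-b / t + c / t ^ 2 + β * ∑ k, (t - y k)⁻¹))
        * (t ^ (-b) * Real.exp (-(c / t)) * ∏ k, |t - y k| ^ β)) t := by
  have h1 : HasDerivAt (fun t : ℝ => t ^ m) (m * t ^ (m - 1)) t := hasDerivAt_pow m t
  have h2 : HasDerivAt (fun t : ℝ => (t + s) ^ r) (r * (t + s) ^ (r - 1)) t :=
    ((((hasDerivAt_id t).add_const s).pow r).congr_deriv (mul_one _) :)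
  have h3 : HasDerivAt (fun t : ℝ => t ^ (-b)) (-b * t ^ (-b - 1)) t :=
    Real.hasDerivAt_rpow_const (Or.inl ht.ne')
  have h4 : HasDerivAt (fun t : ℝ => Real.exp (-(c / t))) (Real.exp (-(c / t)) * (c / t ^ 2)) t := by
    have h : HasDerivAt (fun t : ℝ => -(c / t)) (c / t ^ 2) t :=
      (((hasDerivAt_inv ht.ne').const_mul c).neg.congr_deriv
        (show _ = c / t ^ 2 by ring) :)
    exact h.exp
  have h5 : HasDerivAt (fun t : ℝ => ∏ k, |t - y k| ^ β)
      ((∏ k, |t - y k| ^ β) * (β * ∑ k, (t - y k)⁻¹)) t := by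
    refine (HasDerivAt.fun_finsetProd
      (fun k (_ : k ∈ univ) => hasDerivAt_abs_sub_rpow β (hy k))).congr_deriv ?_
    rw [Finset.mul_sum, Finset.mul_sum]
    refine Finset.sum_congr rfl fun k hk => ?_
    rw [← Finset.prod_erase_mul _ _ hk, smul_eq_mul]
    ring
  refine ((h1.mul h2).mul ((h3.mul h4).mul h5)).congr_deriv ?_
  rw [Real.rpow_sub_one ht.ne']
  simp only [Pi.mul_apply]
  ring

theorem exists_abs_sliceFun_le (hβ : 0 ≤ β) (y : Fin N → ℝ) (s : ℝ) :
    ∃ C : ℝ, 0 < C ∧ ∀ t : ℝ, 0 ≤ t → |sliceFun β b c m r y s t| ≤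
      C * (t ^ (-b) * Real.exp (-(c / t)) * (1 + t) ^ (β * N + (m + r))) := by
  refine ⟨(1 + |s|) ^ r * ∏ k, (1 + |y k|) ^ β, by positivity, fun t ht => ?_⟩
  have h1 : t ^ m ≤ (1 + t) ^ m := by gcongr; linarith
  have h2 : |t + s| ^ r ≤ (1 + t) ^ r * (1 + |s|) ^ r := by
    rw [← mul_pow]
    gcongr
    have := abs_add_le t s
    rw [abs_of_nonneg ht] at this
    nlinarith [abs_nonneg s]
  have h3 : ∏ k, |t - y k| ^ β ≤ (1 + t) ^ (β * N) * ∏ k, (1 + |y k|) ^ β := by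
    calc ∏ k, |t - y k| ^ β ≤ ∏ k, ((1 + t) ^ β * (1 + |y k|) ^ β) :=
          Finset.prod_le_prod (fun k _ => by positivity) fun k _ => abs_sub_rpow_le hβ ht
      _ = _ := by
          rw [Finset.prod_mul_distrib, Finset.prod_const, Finset.card_univ, Fintype.card_fin,
            Real.rpow_mul_natCast (by positivity)]
  rw [sliceFun, abs_mul, abs_mul, abs_pow, abs_pow, abs_of_nonneg ht,
    abs_of_nonneg (a := t ^ (-b) * Real.exp (-(c / t)) * ∏ k, |t - y k| ^ β) (by positivity),
    Real.rpow_add (by positivity), Real.rpow_add (by positivity), Real.rpow_natCast,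
    Real.rpow_natCast]
  calc _ ≤ (1 + t) ^ m * ((1 + t) ^ r * (1 + |s|) ^ r) * (t ^ (-b) * Real.exp (-(c / t)) *
        ((1 + t) ^ (β * N) * ∏ k, (1 + |y k|) ^ β)) := by gcongr
    _ = _ := by ring

theorem continuousOn_sliceFun (hβ : 0 ≤ β) (y : Fin N → ℝ) (s : ℝ) :
    ContinuousOn (sliceFun β b c m r y s) (Set.Ioi 0) := by
  have h1 : ContinuousOn (fun t : ℝ => t ^ (-b)) (Set.Ioi 0) :=
    continuousOn_id.rpow_const fun t ht => Or.inl (ne_of_gt ht)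
  have h2 : ContinuousOn (fun t : ℝ => Real.exp (-(c / t))) (Set.Ioi 0) :=
    (continuousOn_const.div continuousOn_id fun t ht => ne_of_gt ht).neg.rexp
  have h3 : Continuous (fun t : ℝ => ∏ k, |t - y k| ^ β) :=
    continuous_finsetProd _ fun k _ => Continuous.rpow_const (by fun_prop) fun _ => Or.inr hβ
  have h4 : Continuous (fun t : ℝ => t ^ m * (t + s) ^ r) := by fun_prop
  exact h4.continuousOn.mul ((h1.mul h2).mul h3.continuousOn)

theorem tendsto_sliceFun_zero (hβ : 0 ≤ β) (hc : 0 < c) (y : Fin N → ℝ) (s : ℝ) :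
    Tendsto (sliceFun β b c m r y s) (𝓝[>] 0) (𝓝 0) := by
  obtain ⟨C, hC, hle⟩ := exists_abs_sliceFun_le (b := b) (c := c) (m := m) (r := r) hβ y s
  obtain ⟨D, hD, hle'⟩ := exists_rpow_neg_mul_exp_neg_div_le b hc
  set a : ℝ := β * N + (m + r)
  have ha : 0 ≤ a := by positivity
  refine squeeze_zero_norm' (a := fun t => C * (D * t * 2 ^ a)) ?_ ?_
  · filter_upwards [Ioc_mem_nhdsGT (zero_lt_one (α := ℝ))] with t ht
    refine (hle t ht.1.le).trans ?_
    have ht0 : 0 < t := ht.1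
    have h1 := hle' t ht.1 ht.2
    gcongr
    linarith [ht.2]
  · have : Tendsto (fun t => C * (D * t * 2 ^ a)) (𝓝 0) (𝓝 (C * (D * 0 * 2 ^ a))) :=
      Continuous.tendsto (by fun_prop) 0
    simp only [mul_zero, zero_mul] at this
    exact this.mono_left nhdsWithin_le_nhds

theorem tendsto_sliceFun_atTop (hβ : 0 ≤ β) (hc : 0 < c) (hb : β * N + (m + r) - b < 0)
    (y : Fin N → ℝ) (s : ℝ) :
    Tendsto (sliceFun β b c m r y s) atTop (𝓝 0) := by
  obtain ⟨C, hC, hle⟩ := exists_abs_sliceFun_le (b := b) (c := c) (m := m) (r := r) hβ y s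
  set a : ℝ := β * N + (m + r)
  have ha : 0 ≤ a := by positivity
  refine squeeze_zero_norm' (a := fun t => C * (2 ^ a * t ^ (a - b))) ?_ ?_
  · filter_upwards [eventually_ge_atTop 1] with t ht
    refine (hle t (by linarith)).trans ?_
    exact mul_le_mul_of_nonneg_left (rpow_neg_mul_exp_neg_div_mul_rpow_le b ha hc ht) hC.le
  · have := tendsto_rpow_neg_atTop (y := b - a) (by linarith)
    simpa using (this.const_mul (2 ^ a)).const_mul C

theorem integral_deriv_sliceFun (hβ : 0 ≤ β) (hc : 0 < c) (hm : m ≠ 0)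
    (hb : β * N + (m + r) - b < 0) (y : Fin N → ℝ) (s : ℝ) {g : ℝ → ℝ}
    (hg : IntegrableOn g (Set.Ioi 0))
    (hderiv : ∀ t, 0 < t → (∀ k, t ≠ y k) → HasDerivAt (sliceFun β b c m r y s) (g t) t) :
    ∫ t in Set.Ioi 0, g t = 0 := by
  have h0 : sliceFun β b c m r y s 0 = 0 := by simp [sliceFun, hm]
  have hcont : ContinuousOn (sliceFun β b c m r y s) (Set.Ici 0) := by
    intro t ht
    rcases eq_or_lt_of_le (Set.mem_Ici.1 ht) with rfl | ht'
    · rw [← Set.Ioi_insert, continuousWithinAt_insert_self, ContinuousWithinAt, h0]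
      exact tendsto_sliceFun_zero hβ hc y s
    · exact ((continuousOn_sliceFun hβ y s).continuousAt (Ioi_mem_nhds ht')).continuousWithinAt
  refine tendsto_nhds_unique (intervalIntegral_tendsto_integral_Ioi 0 hg tendsto_id) ?_
  refine (tendsto_sliceFun_atTop hβ hc hb y s).congr' ?_
  filter_upwards [eventually_ge_atTop 0] with R hR
  have := integral_eq_of_hasDerivAt_off_countable (sliceFun β b c m r y s) g (a := 0) (b := R)
    (Set.countable_range y) ?_ ?_ ?_
  · rw [id, this, h0, sub_zero]
  · rw [Set.uIcc_of_le hR]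
    exact hcont.mono Set.Icc_subset_Ici_self
  · rintro t ⟨ht, hty⟩
    rw [min_eq_left hR] at ht
    exact hderiv t ht.1 fun k hk => hty ⟨k, hk.symm⟩
  · rw [intervalIntegrable_iff_integrableOn_Ioc_of_le hR]
    exact hg.mono_set Set.Ioc_subset_Ioi_self

end OneVariable

section Ensemble

/-- Lebesgue measure on the open positive orthant, as a product measure. -/
noncomputable def orthantMeasure (n : ℕ) : Measure (Fin n → ℝ) :=
  Measure.pi fun _ => volume.restrict (Set.Ioi 0)

theorem restrict_univ_pi_Ioi (n : ℕ) :
    (volume : Measure (Fin n → ℝ)).restrict (Set.univ.pi fun _ => Set.Ioi 0)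
      = orthantMeasure n := by
  rw [volume_pi, Measure.restrict_pi_pi, orthantMeasure]

theorem ae_orthantMeasure_pos (n : ℕ) : ∀ᵐ τ ∂orthantMeasure n, ∀ i, 0 < τ i := by
  rw [← restrict_univ_pi_Ioi]
  filter_upwards [ae_restrict_mem (MeasurableSet.univ_pi fun _ => measurableSet_Ioi)] with τ hτ i
  exact hτ i (Set.mem_univ i)

/-- The density of the ensemble with a free rate parameter `c` in place of `βn/2`. -/
noncomputable def ensembleDensity (β b c : ℝ) {n : ℕ} (τ : Fin n → ℝ) : ℝ :=
  (∏ j, τ j ^ (-b) * Real.exp (-(c / τ j))) * vand β τ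

theorem wdW_eq_ensembleDensity (β b : ℝ) (n : ℕ) (τ : Fin n → ℝ) :
    wdW β b n τ = ensembleDensity β b (β * n / 2) τ := by
  simp only [wdW, ensembleDensity, div_div]

theorem vand_nonneg (β : ℝ) {n : ℕ} (τ : Fin n → ℝ) : 0 ≤ vand β τ :=
  Finset.prod_nonneg fun _ _ => Finset.prod_nonneg fun _ _ => by positivity

theorem vand_eq_zero {β : ℝ} (hβ : β ≠ 0) {n : ℕ} {τ : Fin n → ℝ}
    (hτ : ¬ Function.Injective τ) : vand β τ = 0 := by
  have key : ∀ i j : Fin n, i < j → τ i = τ j → vand β τ = 0 := fun i j hij h =>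
    Finset.prod_eq_zero (Finset.mem_univ i) <|
      Finset.prod_eq_zero (Finset.mem_Ioi.2 hij) (by rw [h, sub_self, abs_zero, Real.zero_rpow hβ])
  simp only [Function.Injective, not_forall] at hτ
  obtain ⟨i, j, h, hij⟩ := hτ
  rcases lt_or_gt_of_ne hij with h' | h'
  · exact key i j h' h
  · exact key j i h' h.symm

theorem vand_pos {β : ℝ} {n : ℕ} {τ : Fin n → ℝ} (hτ : Function.Injective τ) : 0 < vand β τ :=
  Finset.prod_pos fun _ _ => Finset.prod_pos fun _ hk =>
    Real.rpow_pos_of_pos (abs_pos.2 (sub_ne_zero.2 (hτ.ne (Finset.mem_Ioi.1 hk).ne'))) β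

theorem vand_insertNth (β : ℝ) {N : ℕ} (j : Fin (N + 1)) (t : ℝ) (y : Fin N → ℝ) :
    vand β (j.insertNth t y : Fin (N + 1) → ℝ) = (∏ k, |t - y k| ^ β) * vand β y := by
  have h : ∀ {n : ℕ} (T : Fin n → ℝ),
      vand β T = ∏ i, ∏ k, if i < k then |T k - T i| ^ β else 1 := by
    intro n T
    simp only [vand, ← Finset.filter_lt_eq_Ioi, Finset.prod_filter]
  rw [h, h, Fin.prod_univ_succAbove _ j, Fin.prod_univ_succAbove _ j]
  simp_rw [fun i => Fin.prod_univ_succAbove (fun k => if j.succAbove i < k then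
    |(j.insertNth t y : Fin (N + 1) → ℝ) k - (j.insertNth t y : Fin (N + 1) → ℝ) (j.succAbove i)| ^ β
    else 1) j]
  simp only [Fin.insertNth_apply_same, Fin.insertNth_apply_succAbove, lt_self_iff_false, if_false,
    one_mul, Fin.succAbove_lt_succAbove_iff]
  rw [Finset.prod_mul_distrib, ← mul_assoc, ← Finset.prod_mul_distrib]
  congr 1
  refine Finset.prod_congr rfl fun k _ => ?_
  rcases lt_or_gt_of_ne (Fin.succAbove_ne j k) with h' | h'
  · rw [if_neg h'.not_gt, if_pos h', one_mul]
  · rw [if_pos h', if_neg h'.not_gt, mul_one, abs_sub_comm]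

theorem prod_abs_sub_rpow_le {β t : ℝ} (hβ : 0 ≤ β) {N : ℕ} {y : Fin N → ℝ} (ht : 0 ≤ t)
    (hy : ∀ k, 0 ≤ y k) :
    ∏ k, |t - y k| ^ β ≤ (1 + t) ^ (β * N) * ∏ k, (1 + y k) ^ β := by
  calc ∏ k, |t - y k| ^ β ≤ ∏ k, ((1 + t) ^ β * (1 + y k) ^ β) :=
        Finset.prod_le_prod (fun k _ => by positivity) fun k _ => by
          simpa only [abs_of_nonneg (hy k)] using abs_sub_rpow_le (s := y k) hβ ht
    _ = _ := by
        rw [Finset.prod_mul_distrib, Finset.prod_const, Finset.card_univ, Fintype.card_fin,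
          Real.rpow_mul_natCast (by positivity)]

theorem prod_one_add_rpow_succ (β : ℝ) {N : ℕ} {y : Fin N → ℝ} (hy : ∀ k, 0 ≤ y k) :
    (∏ k, (1 + y k) ^ β) * ∏ k, (1 + y k) ^ (β * (N - 1)) = ∏ k, (1 + y k) ^ (β * N) := by
  rw [← Finset.prod_mul_distrib]
  refine Finset.prod_congr rfl fun k _ => ?_
  have := hy k
  rw [← Real.rpow_add (by positivity)]
  ring_nf

theorem vand_le {β : ℝ} (hβ : 0 ≤ β) {n : ℕ} {τ : Fin n → ℝ} (hτ : ∀ i, 0 ≤ τ i) :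
    vand β τ ≤ ∏ i, (1 + τ i) ^ (β * (n - 1)) := by
  induction n with
  | zero => simp [vand]
  | succ N ih =>
    obtain ⟨t, y, rfl⟩ : ∃ t y, τ = (0 : Fin (N + 1)).insertNth t y :=
      ⟨_, _, (Fin.insertNth_self_removeNth 0 τ).symm⟩
    have ht : 0 ≤ t := by simpa using hτ 0
    have hy : ∀ k, 0 ≤ y k := fun k => by simpa using hτ (Fin.succAbove 0 k)
    rw [vand_insertNth, Fin.prod_univ_succAbove _ 0]
    simp only [Fin.insertNth_apply_same, Fin.insertNth_apply_succAbove, Nat.cast_add, Nat.cast_one,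
      add_sub_cancel_right]
    rw [← prod_one_add_rpow_succ β hy, ← mul_assoc]
    exact mul_le_mul (prod_abs_sub_rpow_le hβ ht hy) (ih hy) (vand_nonneg β y)
      (mul_nonneg (by positivity) (Finset.prod_nonneg fun k _ => by have := hy k; positivity))

theorem vand_mul_le {β : ℝ} (hβ : 1 ≤ β) {N : ℕ} {τ : Fin (N + 1) → ℝ} (hτ : ∀ i, 0 ≤ τ i)
    (i j : Fin (N + 1)) :
    τ j * |(τ j - τ i)⁻¹| * vand β τ ≤ ∏ i, (1 + τ i) ^ (β * N) := by
  have hβ0 : 0 ≤ β := by linarith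
  by_cases hij : τ j = τ i
  · rw [hij, sub_self, inv_zero, abs_zero, mul_zero, zero_mul]
    exact Finset.prod_nonneg fun k _ => by have := hτ k; positivity
  obtain ⟨k, rfl⟩ : ∃ k, j.succAbove k = i := Fin.exists_succAbove_eq fun h => hij (h ▸ rfl)
  obtain ⟨t, y, rfl⟩ : ∃ t y, τ = j.insertNth t y :=
    ⟨_, _, (Fin.insertNth_self_removeNth j τ).symm⟩
  have ht : 0 ≤ t := by simpa using hτ j
  have hy : ∀ k, 0 ≤ y k := fun k => by simpa using hτ (Fin.succAbove j k)
  rw [vand_insertNth, Fin.prod_univ_succAbove _ j]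
  simp only [Fin.insertNth_apply_same, Fin.insertNth_apply_succAbove] at hij ⊢
  have h1 : t * |(t - y k)⁻¹| * ∏ i, |t - y i| ^ β ≤ (1 + t) ^ (β * N) * ∏ i, (1 + y i) ^ β := by
    have h2 : (1 + t) ^ (β * N) * ∏ i, (1 + y i) ^ β = ∏ i, ((1 + t) ^ β * (1 + y i) ^ β) := by
      rw [Finset.prod_mul_distrib, Finset.prod_const, Finset.card_univ, Fintype.card_fin,
        Real.rpow_mul_natCast (by positivity)]
    rw [h2, ← Finset.mul_prod_erase _ _ (Finset.mem_univ k),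
      ← Finset.mul_prod_erase _ _ (Finset.mem_univ k), ← mul_assoc]
    have hyk := hy k
    have h3 : t * |(t - y k)⁻¹| * |t - y k| ^ β ≤ (1 + t) ^ β * (1 + y k) ^ β := by
      have h4 : |t - y k| ≠ 0 := abs_ne_zero.2 (sub_ne_zero.2 hij)
      have h5 := abs_sub_rpow_le (s := y k) (sub_nonneg.2 hβ) ht
      rw [abs_of_nonneg hyk] at h5
      calc t * |(t - y k)⁻¹| * |t - y k| ^ β = t * |t - y k| ^ (β - 1) := by
            rw [Real.rpow_sub_one h4, abs_inv]; ring
        _ ≤ (1 + t) * ((1 + t) ^ (β - 1) * (1 + y k) ^ (β - 1)) := by gcongr; linarith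
        _ = (1 + t) ^ β * (1 + y k) ^ (β - 1) := by
            rw [Real.rpow_sub_one (by positivity)]; field_simp
        _ ≤ _ := by gcongr <;> linarith
    refine mul_le_mul h3 (Finset.prod_le_prod (fun k _ => by positivity) fun k _ => ?_)
      (Finset.prod_nonneg fun k _ => by positivity) (by positivity)
    simpa only [abs_of_nonneg (hy k)] using abs_sub_rpow_le (s := y k) hβ0 ht
  rw [← prod_one_add_rpow_succ β hy, ← mul_assoc, ← mul_assoc]
  exact mul_le_mul h1 (vand_le hβ0 hy) (vand_nonneg β y)
      (mul_nonneg (by positivity) (Finset.prod_nonneg fun k _ => by have := hy k; positivity))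

theorem one_add_sum_le_prod_one_add {n : ℕ} {τ : Fin n → ℝ} (hτ : ∀ i, 0 ≤ τ i) :
    1 + ∑ i, τ i ≤ ∏ i, (1 + τ i) := by
  induction n with
  | zero => simp
  | succ N ih =>
    rw [Fin.sum_univ_succ, Fin.prod_univ_succ]
    have h := ih fun i => hτ i.succ
    have h0 := hτ 0
    have hs : 0 ≤ ∑ i : Fin N, τ i.succ := Finset.sum_nonneg fun i _ => hτ i.succ
    nlinarith

/-- A dominating function for the density and its logarithmic derivatives. -/
noncomputable def densityBound (β b c : ℝ) {N : ℕ} (τ : Fin (N + 1) → ℝ) : ℝ :=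
  (∏ i, τ i ^ (-b) * Real.exp (-(c / τ i))) * ∏ i, (1 + τ i) ^ (β * N)

variable {β b c : ℝ} {N : ℕ}

theorem ensembleDensity_nonneg {n : ℕ} {τ : Fin n → ℝ} (hτ : ∀ i, 0 < τ i) :
    0 ≤ ensembleDensity β b c τ :=
  mul_nonneg (Finset.prod_nonneg fun i _ => by have := hτ i; positivity) (vand_nonneg β τ)

theorem ensembleDensity_le (hβ : 0 ≤ β) {τ : Fin (N + 1) → ℝ} (hτ : ∀ i, 0 < τ i) :
    ensembleDensity β b c τ ≤ densityBound β b c τ := by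
  have h := vand_le hβ fun i => (hτ i).le
  rw [Nat.cast_succ, add_sub_cancel_right] at h
  exact mul_le_mul_of_nonneg_left h (Finset.prod_nonneg fun i _ => by have := hτ i; positivity)

theorem mul_ensembleDensity_le (hβ : 1 ≤ β) {τ : Fin (N + 1) → ℝ} (hτ : ∀ i, 0 < τ i)
    (i j : Fin (N + 1)) :
    τ j * |(τ j - τ i)⁻¹| * ensembleDensity β b c τ ≤ densityBound β b c τ := by
  rw [ensembleDensity, mul_left_comm]
  exact mul_le_mul_of_nonneg_left (vand_mul_le hβ (fun i => (hτ i).le) i j)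
    (Finset.prod_nonneg fun i _ => by have := hτ i; positivity)

theorem measurable_vand (β : ℝ) (n : ℕ) : Measurable (vand β : (Fin n → ℝ) → ℝ) := by
  unfold vand
  fun_prop

theorem measurable_ensembleDensity (β b c : ℝ) (n : ℕ) :
    Measurable (ensembleDensity β b c : (Fin n → ℝ) → ℝ) := by
  have := measurable_vand β n
  unfold ensembleDensity
  fun_prop

theorem integrable_of_abs_le_densityBound (hβ : 0 ≤ β) (hc : 0 < c) (hb : β * N + 4 - b < 0)
    {f : (Fin (N + 1) → ℝ) → ℝ} (hf : Measurable f) (C : ℝ)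
    (hle : ∀ τ, (∀ i, 0 < τ i) → |f τ| ≤ C * (∏ i, (1 + τ i)) ^ 3 * densityBound β b c τ) :
    Integrable f (orthantMeasure (N + 1)) := by
  have h1 : IntegrableOn
      (fun t : ℝ => t ^ (-b) * Real.exp (-(c / t)) * (1 + t) ^ (β * N + 3)) (Set.Ioi 0) :=
    integrableOn_rpow_neg_mul_exp_neg_div_mul_rpow (by positivity) hc (by linarith)
  have h2 := Integrable.fintype_prod (ι := Fin (N + 1)) (fun _ => h1)
  refine Integrable.mono' (h2.const_mul C) hf.aestronglyMeasurable ?_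
  filter_upwards [ae_orthantMeasure_pos (N + 1)] with τ hτ
  refine (hle τ hτ).trans_eq ?_
  rw [densityBound, mul_assoc, ← Finset.prod_pow, ← Finset.prod_mul_distrib,
    ← Finset.prod_mul_distrib]
  congr 1
  refine Finset.prod_congr rfl fun i _ => ?_
  have := hτ i
  rw [Real.rpow_add (by positivity)]
  norm_cast
  ring

theorem integrable_mul_ensembleDensity (hβ : 0 ≤ β) (hc : 0 < c) (hb : β * N + 4 - b < 0)
    {f : (Fin (N + 1) → ℝ) → ℝ} (hf : Measurable f) (C : ℝ)
    (hle : ∀ τ, (∀ i, 0 < τ i) → |f τ| ≤ C * (∏ i, (1 + τ i)) ^ 3) :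
    Integrable (fun τ => f τ * ensembleDensity β b c τ) (orthantMeasure (N + 1)) := by
  refine integrable_of_abs_le_densityBound hβ hc hb
    (hf.mul (measurable_ensembleDensity β b c _)) C fun τ hτ => ?_
  rw [abs_mul, abs_of_nonneg (ensembleDensity_nonneg hτ)]
  exact mul_le_mul (hle τ hτ) (ensembleDensity_le hβ hτ) (ensembleDensity_nonneg hτ)
    ((abs_nonneg _).trans (hle τ hτ))

end Ensemble

section LoopEquations

/-- The `j`-th partial derivative of `τ_j ^ m * (∑ i, τ_i) ^ r * ensembleDensity β b c τ`, divided by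
the density. -/
noncomputable def loopTerm (β b c : ℝ) (m r : ℕ) {n : ℕ} (j : Fin n) (τ : Fin n → ℝ) : ℝ :=
  m * τ j ^ (m - 1) * (∑ i, τ i) ^ r + r * τ j ^ m * (∑ i, τ i) ^ (r - 1)
    + τ j ^ m * (∑ i, τ i) ^ r * (-b / τ j + c / τ j ^ 2 + β * ∑ k, (τ j - τ k)⁻¹)

theorem measurable_loopTerm (β b c : ℝ) (m r : ℕ) {n : ℕ} (j : Fin n) :
    Measurable (loopTerm β b c m r j : (Fin n → ℝ) → ℝ) := by
  unfold loopTerm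
  fun_prop

variable {β b c : ℝ} {m r N : ℕ}

theorem abs_monomial_le {τ : Fin (N + 1) → ℝ} (hτ : ∀ i, 0 < τ i) (j : Fin (N + 1)) {k l : ℕ}
    (hkl : k + l ≤ 3) :
    |τ j ^ k * (∑ i, τ i) ^ l| ≤ (∏ i, (1 + τ i)) ^ 3 := by
  have hs : ∑ i, τ i ≤ ∏ i, (1 + τ i) := by
    linarith [one_add_sum_le_prod_one_add fun i => (hτ i).le]
  have hs0 : 0 ≤ ∑ i, τ i := Finset.sum_nonneg fun i _ => (hτ i).le
  have h1 : 1 ≤ ∏ i, (1 + τ i) := by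
    linarith [one_add_sum_le_prod_one_add fun i => (hτ i).le]
  have hj0 : 0 ≤ τ j := (hτ j).le
  have hj : τ j ≤ ∏ i, (1 + τ i) :=
    (Finset.single_le_sum (fun i _ => (hτ i).le) (Finset.mem_univ j)).trans hs
  rw [abs_of_nonneg (by positivity)]
  calc τ j ^ k * (∑ i, τ i) ^ l ≤ (∏ i, (1 + τ i)) ^ k * (∏ i, (1 + τ i)) ^ l := by gcongr
    _ = (∏ i, (1 + τ i)) ^ (k + l) := (pow_add _ _ _).symm
    _ ≤ _ := pow_le_pow_right₀ h1 hkl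

theorem loopTerm_eq {n : ℕ} {τ : Fin n → ℝ} (j : Fin n) (hτ : τ j ≠ 0) (m r : ℕ) :
    loopTerm β b c (m + 2) r j τ = (m + 2 - b) * (τ j ^ (m + 1) * (∑ i, τ i) ^ r)
      + r * (τ j ^ (m + 2) * (∑ i, τ i) ^ (r - 1)) + c * (τ j ^ m * (∑ i, τ i) ^ r)
      + β * ∑ k, τ j ^ (m + 2) * (∑ i, τ i) ^ r * (τ j - τ k)⁻¹ := by
  rw [loopTerm, ← Finset.mul_sum]
  push_cast
  field_simp
  ring

theorem integrable_loopTerm_mul (hβ : 1 ≤ β) (hc : 0 < c) (hb : β * N + 4 - b < 0)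
    (hmr : m + r ≤ 2) (j : Fin (N + 1)) :
    Integrable (fun τ => loopTerm β b c (m + 2) r j τ * ensembleDensity β b c τ)
      (orthantMeasure (N + 1)) := by
  have hβ0 : 0 ≤ β := by linarith
  refine integrable_of_abs_le_densityBound hβ0 hc hb
    ((measurable_loopTerm β b c _ r j).mul (measurable_ensembleDensity β b c _))
    (|m + 2 - b| + r + c + β * (N + 1)) fun τ hτ => ?_
  set Q := ∏ i, (1 + τ i)
  set R := densityBound β b c τ
  set W := ensembleDensity β b c τ
  have hW0 : 0 ≤ W := ensembleDensity_nonneg hτ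
  have hWR : W ≤ R := ensembleDensity_le hβ0 hτ
  have hR0 : 0 ≤ R := hW0.trans hWR
  have hQ : 0 ≤ Q ^ 3 := (abs_nonneg _).trans (abs_monomial_le hτ j (k := 0) (l := 0) (by simp))
  have h1 := abs_monomial_le hτ j (k := m + 1) (l := r) (by omega)
  have h2 : |r * (τ j ^ (m + 2) * (∑ i, τ i) ^ (r - 1))| ≤ r * Q ^ 3 := by
    rcases Nat.eq_zero_or_pos r with rfl | hr
    · simp
    · rw [abs_mul, Nat.abs_cast]
      exact mul_le_mul_of_nonneg_left (abs_monomial_le hτ j (by omega)) (by positivity)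
  have h3 := abs_monomial_le hτ j (k := m) (l := r) (by omega)
  have h4 : ∀ k, |τ j ^ (m + 2) * (∑ i, τ i) ^ r * (τ j - τ k)⁻¹ * W| ≤ Q ^ 3 * R := fun k => by
    calc |τ j ^ (m + 2) * (∑ i, τ i) ^ r * (τ j - τ k)⁻¹ * W|
        = |τ j ^ (m + 1) * (∑ i, τ i) ^ r| * (τ j * |(τ j - τ k)⁻¹| * W) := by
          rw [pow_succ (τ j) (m + 1)]
          simp only [abs_mul, abs_of_nonneg (hτ j).le, abs_of_nonneg hW0]
          ring
      _ ≤ _ := mul_le_mul h1 (mul_ensembleDensity_le hβ hτ k j)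
          (mul_nonneg (mul_nonneg (hτ j).le (abs_nonneg _)) hW0) hQ
  have h5 : |(m + 2 - b) * (τ j ^ (m + 1) * (∑ i, τ i) ^ r)
      + r * (τ j ^ (m + 2) * (∑ i, τ i) ^ (r - 1)) + c * (τ j ^ m * (∑ i, τ i) ^ r)|
      ≤ |m + 2 - b| * Q ^ 3 + r * Q ^ 3 + c * Q ^ 3 := by
    refine (abs_add_three _ _ _).trans ?_
    rw [abs_mul (m + 2 - b : ℝ), abs_mul c, abs_of_pos hc]
    gcongr
  have h6 : |(∑ k, τ j ^ (m + 2) * (∑ i, τ i) ^ r * (τ j - τ k)⁻¹) * W| ≤ (N + 1) * (Q ^ 3 * R) := by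
    rw [Finset.sum_mul]
    refine (Finset.abs_sum_le_sum_abs _ _).trans ((Finset.sum_le_sum fun k _ => h4 k).trans_eq ?_)
    simp
  rw [loopTerm_eq j (hτ j).ne', add_mul, mul_assoc β]
  refine (abs_add_le _ _).trans ?_
  rw [abs_mul _ W, abs_mul β, abs_of_nonneg hβ0, abs_of_nonneg hW0]
  calc _ ≤ (|m + 2 - b| * Q ^ 3 + r * Q ^ 3 + c * Q ^ 3) * R + β * ((N + 1) * (Q ^ 3 * R)) := by
        gcongr
    _ = _ := by ring

theorem integral_loopTerm_mul (hβ : 1 ≤ β) (hc : 0 < c) (hb : β * N + 4 - b < 0)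
    (hmr : m + r ≤ 2) (j : Fin (N + 1)) :
    ∫ τ, loopTerm β b c (m + 2) r j τ * ensembleDensity β b c τ ∂orthantMeasure (N + 1) = 0 := by
  have hint := integrable_loopTerm_mul hβ hc hb hmr j
  have hmp := (measurePreserving_piFinSuccAbove
    (fun _ : Fin (N + 1) => (volume : Measure ℝ).restrict (Set.Ioi 0)) j).symm
  have hint' := (hmp.integrable_comp_emb (MeasurableEquiv.measurableEmbedding _)).2 hint
  rw [orthantMeasure, ← hmp.integral_comp']
  refine (integral_prod_symm _ hint').trans (integral_eq_zero_of_ae ?_)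
  filter_upwards [hint'.prod_left_ae] with y hy
  set K := (∏ k, y k ^ (-b) * Real.exp (-(c / y k))) * vand β y with hK
  set g : ℝ → ℝ := fun t =>
    (((m + 2 : ℕ) : ℝ) * t ^ (m + 2 - 1) * (t + ∑ i, y i) ^ r
        + r * t ^ (m + 2) * (t + ∑ i, y i) ^ (r - 1)
        + t ^ (m + 2) * (t + ∑ i, y i) ^ r * (-b / t + c / t ^ 2 + β * ∑ k, (t - y k)⁻¹))
        * (t ^ (-b) * Real.exp (-(c / t)) * ∏ k, |t - y k| ^ β) with hg
  have key : ∀ t : ℝ, loopTerm β b c (m + 2) r j (j.insertNth t y)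
      * ensembleDensity β b c (j.insertNth t y : Fin (N + 1) → ℝ) = K * g t := fun t => by
    rw [loopTerm, ensembleDensity, vand_insertNth, Fin.sum_univ_succAbove _ j,
      Fin.prod_univ_succAbove _ j, Fin.sum_univ_succAbove _ j]
    simp only [Fin.insertNth_apply_same, Fin.insertNth_apply_succAbove, sub_self, inv_zero,
      zero_add, hK, hg]
    ring
  have hy' : Integrable (fun t => K * g t) (volume.restrict (Set.Ioi 0)) :=
    hy.congr (ae_of_all _ key)
  have hgoal : ∫ t in Set.Ioi 0, K * g t = 0 := by
    rcases eq_or_ne K 0 with h0 | h0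
    · simp [h0]
    · rw [integral_const_mul, integral_deriv_sliceFun (b := b) (m := m + 2) (r := r)
        (by linarith) hc (by omega) ?_ y (∑ i, y i) ((integrable_const_mul_iff
          (isUnit_iff_ne_zero.2 h0) g).1 hy') fun t ht hty => hasDerivAt_sliceFun y _ ht hty,
        mul_zero]
      have : (m : ℝ) + r ≤ 2 := mod_cast hmr
      push_cast
      linarith
  exact (integral_congr_ae (ae_of_all _ key)).trans hgoal

theorem sum_loopTerm_eq {n : ℕ} {τ : Fin n → ℝ} (hτ : ∀ j, τ j ≠ 0) (m r : ℕ) :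
    ∑ j, loopTerm β b c (m + 2) r j τ = (m + 2 - b) * ((∑ j, τ j ^ (m + 1)) * (∑ i, τ i) ^ r)
      + r * ((∑ j, τ j ^ (m + 2)) * (∑ i, τ i) ^ (r - 1)) + c * ((∑ j, τ j ^ m) * (∑ i, τ i) ^ r)
      + β * ((∑ j, ∑ k, τ j ^ (m + 2) * (τ j - τ k)⁻¹) * (∑ i, τ i) ^ r) := by
  simp only [Finset.sum_congr rfl fun j _ => loopTerm_eq j (hτ j) m r, Finset.sum_add_distrib,
    ← Finset.mul_sum, Finset.sum_mul]
  congr 2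
  refine Finset.sum_congr rfl fun j _ => ?_
  ring

theorem two_mul_sum_pow_mul_inv_sub {n : ℕ} (τ : Fin n → ℝ) (m : ℕ) :
    2 * ∑ j, ∑ k, τ j ^ m * (τ j - τ k)⁻¹ = ∑ j, ∑ k, (τ j ^ m - τ k ^ m) * (τ j - τ k)⁻¹ := by
  have h : ∑ j, ∑ k, τ j ^ m * (τ j - τ k)⁻¹ = - ∑ j, ∑ k, τ k ^ m * (τ j - τ k)⁻¹ := by
    rw [Finset.sum_comm, ← Finset.sum_neg_distrib]
    refine Finset.sum_congr rfl fun j _ => ?_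
    rw [← Finset.sum_neg_distrib]
    refine Finset.sum_congr rfl fun k _ => ?_
    rw [← neg_sub (τ j) (τ k), inv_neg]
    ring
  simp only [sub_mul, Finset.sum_sub_distrib]
  linarith

theorem sum_pow_sub_mul_inv_sub {n : ℕ} {τ : Fin n → ℝ} (hτ : Function.Injective τ) {m : ℕ}
    {p : ℝ → ℝ → ℝ} (hp : ∀ x y, x ^ m - y ^ m = p x y * (x - y)) :
    ∑ j, ∑ k, (τ j ^ m - τ k ^ m) * (τ j - τ k)⁻¹
      = ∑ j, ∑ k, p (τ j) (τ k) - ∑ j, p (τ j) (τ j) := by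
  rw [← Finset.sum_sub_distrib]
  refine Finset.sum_congr rfl fun j _ => ?_
  rw [← Finset.add_sum_erase _ _ (Finset.mem_univ j), ← Finset.add_sum_erase _ _ (Finset.mem_univ j)]
  simp only [sub_self, zero_mul, zero_add, add_sub_cancel_left]
  refine Finset.sum_congr rfl fun k hk => ?_
  have : τ j - τ k ≠ 0 := sub_ne_zero.2 (hτ.ne (Finset.ne_of_mem_erase hk).symm)
  rw [hp, mul_assoc, mul_inv_cancel₀ this, mul_one]

theorem sum_sq_mul_inv_sub {n : ℕ} {τ : Fin n → ℝ} (hτ : Function.Injective τ) :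
    ∑ j, ∑ k, τ j ^ 2 * (τ j - τ k)⁻¹ = (n - 1) * ∑ j, τ j := by
  have h := two_mul_sum_pow_mul_inv_sub τ 2
  rw [sum_pow_sub_mul_inv_sub hτ (p := fun x y => x + y) (fun x y => by ring)] at h
  simp only [Finset.sum_add_distrib, Finset.sum_const, Finset.card_univ, Fintype.card_fin,
    nsmul_eq_mul, ← Finset.mul_sum] at h ⊢
  linarith

theorem sum_cube_mul_inv_sub {n : ℕ} {τ : Fin n → ℝ} (hτ : Function.Injective τ) :
    ∑ j, ∑ k, τ j ^ 3 * (τ j - τ k)⁻¹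
      = (n - 3 / 2) * ∑ j, τ j ^ 2 + (∑ j, τ j) ^ 2 / 2 := by
  have h := two_mul_sum_pow_mul_inv_sub τ 3
  rw [sum_pow_sub_mul_inv_sub hτ (p := fun x y => x ^ 2 + x * y + y ^ 2) (fun x y => by ring)] at h
  simp only [Finset.sum_add_distrib, Finset.sum_const, Finset.card_univ, Fintype.card_fin,
    nsmul_eq_mul, ← Finset.mul_sum, ← Finset.sum_mul, ← sq] at h ⊢
  linarith

theorem sum_pow_four_mul_inv_sub {n : ℕ} {τ : Fin n → ℝ} (hτ : Function.Injective τ) :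
    ∑ j, ∑ k, τ j ^ 4 * (τ j - τ k)⁻¹
      = (n - 2) * ∑ j, τ j ^ 3 + (∑ j, τ j ^ 2) * ∑ j, τ j := by
  have h := two_mul_sum_pow_mul_inv_sub τ 4
  rw [sum_pow_sub_mul_inv_sub hτ (p := fun x y => x ^ 3 + x ^ 2 * y + x * y ^ 2 + y ^ 3)
    (fun x y => by ring)] at h
  simp only [Finset.sum_add_distrib, Finset.sum_const, Finset.card_univ, Fintype.card_fin,
    nsmul_eq_mul, ← Finset.mul_sum, ← Finset.sum_mul, ← pow_succ, ← pow_succ', Nat.reduceAdd] at h ⊢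
  linarith

/-- The integral of an observable against the unnormalized density. -/
noncomputable def moment (β b c : ℝ) {n : ℕ} (f : (Fin n → ℝ) → ℝ) : ℝ :=
  ∫ τ, f τ * ensembleDensity β b c τ ∂orthantMeasure n

theorem moment_sum_loopTerm (hβ : 1 ≤ β) (hc : 0 < c) (hb : β * N + 4 - b < 0)
    (hmr : m + r ≤ 2) {f : (Fin (N + 1) → ℝ) → ℝ}
    (hf : ∀ τ, (∀ j, 0 < τ j) → Function.Injective τ →
      f τ = ∑ j, loopTerm β b c (m + 2) r j τ) :
    moment β b c f = 0 := by
  calc moment β b c f = ∫ τ, ∑ j, loopTerm β b c (m + 2) r j τ * ensembleDensity β b c τ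
        ∂orthantMeasure (N + 1) := by
        refine integral_congr_ae ?_
        filter_upwards [ae_orthantMeasure_pos (N + 1)] with τ hτ
        by_cases hinj : Function.Injective τ
        · rw [hf τ hτ hinj, Finset.sum_mul]
        · simp [ensembleDensity, vand_eq_zero (by linarith : β ≠ 0) hinj]
    _ = 0 := by
        rw [integral_finsetSum _ fun j _ => integrable_loopTerm_mul hβ hc hb hmr j]
        exact Finset.sum_eq_zero fun j _ => integral_loopTerm_mul hβ hc hb hmr j

end LoopEquations

section PowerMoments

/-- The unnormalized mixed moment of power sums `∫ p_k p_1 ^ l`. -/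
noncomputable def powerMoment (β b c : ℝ) (n k l : ℕ) : ℝ :=
  moment β b c fun τ : Fin n → ℝ => (∑ j, τ j ^ k) * (∑ j, τ j) ^ l

variable {β b c : ℝ} {N : ℕ}

theorem integrable_powerSum_mul (hβ : 0 ≤ β) (hc : 0 < c) (hb : β * N + 4 - b < 0) {k l : ℕ}
    (hkl : k + l ≤ 3) :
    Integrable (fun τ : Fin (N + 1) → ℝ =>
      (∑ j, τ j ^ k) * (∑ j, τ j) ^ l * ensembleDensity β b c τ) (orthantMeasure (N + 1)) := by
  refine integrable_mul_ensembleDensity hβ hc hb (by fun_prop) (N + 1) fun τ hτ => ?_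
  rw [Finset.sum_mul]
  refine (Finset.abs_sum_le_sum_abs _ _).trans
    ((Finset.sum_le_sum fun j _ => abs_monomial_le hτ j hkl).trans_eq ?_)
  simp

theorem moment_linear_combination (hβ : 0 ≤ β) (hc : 0 < c) (hb : β * N + 4 - b < 0)
    {ι : Type*} [Fintype ι] (a : ι → ℝ) (k l : ι → ℕ) (hkl : ∀ i, k i + l i ≤ 3) :
    moment β b c (fun τ : Fin (N + 1) → ℝ =>
      ∑ i, a i * ((∑ j, τ j ^ k i) * (∑ j, τ j) ^ l i))
      = ∑ i, a i * powerMoment β b c (N + 1) (k i) (l i) := by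
  simp only [moment, powerMoment, Finset.sum_mul, ← integral_const_mul]
  rw [← integral_finsetSum]
  · simp only [Finset.sum_mul, mul_assoc]
  · intro i _
    refine ((integrable_powerSum_mul hβ hc hb (hkl i)).const_mul (a i)).congr
      (ae_of_all _ fun τ => ?_)
    simp only [Finset.sum_mul]

theorem powerMoment_zero_succ (β b c : ℝ) (n l : ℕ) :
    powerMoment β b c n 0 (l + 1) = n * powerMoment β b c n 1 l := by
  rw [powerMoment, powerMoment, moment, moment, ← integral_const_mul]
  refine integral_congr_ae (ae_of_all _ fun τ => ?_)
  simp only [pow_zero, pow_one, Finset.sum_const, Finset.card_univ, Fintype.card_fin, nsmul_eq_mul,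
    pow_succ (∑ j, τ j)]
  ring

theorem powerMoment_loop_zero (hβ : 1 ≤ β) (hc : 0 < c) (hb : β * N + 4 - b < 0) {r : ℕ}
    (hr : r ≤ 2) :
    (2 - b + β * N) * powerMoment β b c (N + 1) 1 r + r * powerMoment β b c (N + 1) 2 (r - 1)
      + c * powerMoment β b c (N + 1) 0 r = 0 := by
  have h := moment_linear_combination (by linarith : 0 ≤ β) hc hb
    ![2 - b + β * N, (r : ℝ), c] ![1, 2, 0] ![r, r - 1, r]
    (by simp [Fin.forall_fin_succ]; omega)
  rw [moment_sum_loopTerm hβ hc hb (m := 0) (r := r) (by omega)] at h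
  · simpa [Fin.sum_univ_three] using h.symm
  · intro τ hτ hinj
    rw [sum_loopTerm_eq (fun j => (hτ j).ne'), sum_sq_mul_inv_sub hinj]
    simp [Fin.sum_univ_three]
    ring

theorem powerMoment_loop_one (hβ : 1 ≤ β) (hc : 0 < c) (hb : β * N + 4 - b < 0) {r : ℕ}
    (hr : r ≤ 1) :
    (3 - b + β * (N - 1 / 2)) * powerMoment β b c (N + 1) 2 r
      + r * powerMoment β b c (N + 1) 3 (r - 1) + c * powerMoment β b c (N + 1) 1 r
      + β / 2 * powerMoment β b c (N + 1) 1 (r + 1) = 0 := by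
  have h := moment_linear_combination (by linarith : 0 ≤ β) hc hb
    ![3 - b + β * (N - 1 / 2), (r : ℝ), c, β / 2] ![2, 3, 1, 1] ![r, r - 1, r, r + 1]
    (by simp [Fin.forall_fin_succ]; omega)
  rw [moment_sum_loopTerm hβ hc hb (m := 1) (r := r) (by omega)] at h
  · simpa [Fin.sum_univ_four] using h.symm
  · intro τ hτ hinj
    rw [sum_loopTerm_eq (fun j => (hτ j).ne'), sum_cube_mul_inv_sub hinj]
    simp [Fin.sum_univ_four]
    ring

theorem powerMoment_loop_two (hβ : 1 ≤ β) (hc : 0 < c) (hb : β * N + 4 - b < 0) :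
    (4 - b + β * (N - 1)) * powerMoment β b c (N + 1) 3 0 + c * powerMoment β b c (N + 1) 2 0
      + β * powerMoment β b c (N + 1) 2 1 = 0 := by
  have h := moment_linear_combination (by linarith : 0 ≤ β) hc hb
    ![4 - b + β * (N - 1), c, β] ![3, 2, 2] ![0, 0, 1] (by simp [Fin.forall_fin_succ])
  rw [moment_sum_loopTerm hβ hc hb (m := 2) (r := 0) (by omega)] at h
  · simpa [Fin.sum_univ_three] using h.symm
  · intro τ hτ hinj
    rw [sum_loopTerm_eq (fun j => (hτ j).ne'), sum_pow_four_mul_inv_sub hinj]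
    simp [Fin.sum_univ_three]
    ring

theorem powerMoment_zero_zero_pos (hβ : 0 ≤ β) (hc : 0 < c) (hb : β * N + 4 - b < 0) :
    0 < powerMoment β b c (N + 1) 0 0 := by
  have hint := integrable_powerSum_mul hβ hc hb (k := 0) (l := 0) (by simp)
  rw [powerMoment, moment, integral_pos_iff_support_of_nonneg_ae ?_ hint]
  · set U : Set (Fin (N + 1) → ℝ) := {τ | (∀ i, 0 < τ i) ∧ ∀ i j, i ≠ j → τ i ≠ τ j} with hU
    have hopen : IsOpen U := by
      simp only [hU, Set.ofPred_and, Set.ofPred_forall]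
      refine IsOpen.inter (isOpen_iInter_of_finite fun i => ?_) (isOpen_iInter_of_finite fun i =>
        isOpen_iInter_of_finite fun j => isOpen_iInter_of_finite fun _ => ?_)
      · exact isOpen_lt continuous_const (continuous_apply i)
      · exact isOpen_ne_fun (continuous_apply i) (continuous_apply j)
    have hne : U.Nonempty := ⟨fun i => (i : ℝ) + 1, fun i => by positivity, fun i j hij h =>
      hij (Fin.ext (by exact_mod_cast add_right_cancel h))⟩
    rw [← restrict_univ_pi_Ioi]
    refine (hopen.measure_pos volume hne).trans_le ?_
    rw [← Measure.restrict_eq_self volume (t := Set.univ.pi fun _ : Fin (N + 1) => Set.Ioi (0 : ℝ))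
      (s := U) fun τ hτ i _ => hτ.1 i]
    refine measure_mono fun τ hτ => ?_
    have hinj : Function.Injective τ := fun i j h => by_contra fun hij => hτ.2 i j hij h
    have hpos : 0 < ensembleDensity β b c τ := mul_pos (Finset.prod_pos fun i _ => by
      have := hτ.1 i
      positivity) (vand_pos hinj)
    simp only [pow_zero, Finset.sum_const, Finset.card_univ, Fintype.card_fin, nsmul_eq_mul,
      Function.mem_support, mul_one]
    positivity
  · filter_upwards [ae_orthantMeasure_pos (N + 1)] with τ hτ
    have := ensembleDensity_nonneg (β := β) (b := b) (c := c) hτ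
    simp only [pow_zero, Finset.sum_const, Finset.card_univ, Fintype.card_fin, nsmul_eq_mul,
      mul_one, Pi.zero_apply]
    positivity

theorem wdE_eq_moment_div (β b : ℝ) (n : ℕ) (f : (Fin n → ℝ) → ℝ) :
    wdE β b n f = moment β b (β * n / 2) f / moment β b (β * n / 2) fun _ : Fin n → ℝ => 1 := by
  simp only [wdE, moment, restrict_univ_pi_Ioi, wdW_eq_ensembleDensity, one_mul]

end PowerMoments

theorem third_central_of_loop_equations {n β c Z A₁ A₂ A₃ C D G : ℝ} (hβ : 1 ≤ β)
    (hcn : c = β * n / 2) (hc : 2 < c) (h₁ : -c * A₁ + c * (n * Z) = 0)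
    (h₂ : -c * A₂ + C + c * (n * A₁) = 0) (h₃ : -c * A₃ + 2 * D + c * (n * A₂) = 0)
    (h₄ : (1 - c - β / 2) * C + c * A₁ + β / 2 * A₂ = 0)
    (h₅ : (1 - c - β / 2) * D + G + c * A₂ + β / 2 * A₃ = 0)
    (h₆ : (2 - c - β) * G + c * C + β * D = 0) :
    A₁ = n * Z ∧ (A₃ - 3 * n * A₂ + 2 * n ^ 3 * Z) * ((n + 1) * (n + 2) * (c - 1) * (c - 2))
      = 24 * n ^ 3 * Z := by
  have hA₁ : A₁ = n * Z := mul_left_cancel₀ (by linarith : c ≠ 0) (by linarith)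
  refine ⟨hA₁, ?_⟩
  subst hA₁
  have hA₂ : A₂ * (c - 1) * (n + 1) = n ^ 2 * Z * ((n + 1) * c - (n - 1)) := by
    refine mul_left_cancel₀ (by linarith : β ≠ 0) ?_
    subst hcn
    linear_combination (-2) * h₄ + 2 * (1 - β * n / 2 - β / 2) * h₂
  have hA₃ : -A₃ * ((c - 2) * (c + β) * (c + β / 2 - 1)) / 2
      - A₂ * (c * n * (β - (2 - c - β) * (1 - c - β / 2)) / 2 + (2 - c - β) * c - c ^ 2)
      - c ^ 2 * n ^ 2 * Z = 0 := by
    linear_combination h₆ - (2 - c - β) * h₅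
      - (β - (2 - c - β) * (1 - c - β / 2)) / 2 * h₃ - c * h₂
  have hP : (c - 2) * (c + β) * (c + β / 2 - 1) ≠ 0 := by
    have h1 : 0 < c - 2 := by linarith
    have h2 : 0 < c + β / 2 - 1 := by linarith
    positivity
  refine mul_left_cancel₀ hP ?_
  subst hcn
  linear_combination (-2) * (n + 1) * (n + 2) * ((β * n / 2) - 1) * ((β * n / 2) - 2) * hA₃
    + (n + 2) * ((β * n / 2) - 2) * (-3 * n * (((β * n / 2) - 2) * ((β * n / 2) + β) * ((β * n / 2) + β / 2 - 1))
      - 2 * ((β * n / 2) * n * (β - (2 - (β * n / 2) - β) * (1 - (β * n / 2) - β / 2)) / 2 + (2 - (β * n / 2) - β) * (β * n / 2) - (β * n / 2) ^ 2)) * hA₂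

/-- The third cumulant (third central moment) of the Wigner delay time:
`K_3^{(β)} = 96/((n+1)(n+2)(nβ−2)(nβ−4))`, for `β ∈ {1,2,4}` with `βn > 4`. -/
theorem wigner_delay_time_third_cumulant
    (β : ℝ) (hβ : β = 1 ∨ β = 2 ∨ β = 4) (n : ℕ) (hn : 1 ≤ n) (hβn : 4 < β * n)
    (b : ℝ) (hb : b = 3 * β * n / 2 + 2 - β) :
    wdE β b n (fun τ =>
        ((1 / (n : ℝ)) * ∑ j, τ j
          - wdE β b n (fun τ' => (1 / (n : ℝ)) * ∑ j, τ' j)) ^ 3)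
      = 96 / ((n + 1) * (n + 2) * (n * β - 2) * (n * β - 4)) := by
  have hβ1 : 1 ≤ β := by rcases hβ with rfl | rfl | rfl <;> norm_num
  have hβ0 : 0 ≤ β := by linarith
  obtain ⟨N, rfl⟩ : ∃ N, n = N + 1 := ⟨n - 1, by omega⟩
  set c : ℝ := β * (N + 1 : ℕ) / 2 with hc
  have hcN : c = β * (N + 1) / 2 := by rw [hc]; push_cast; ring
  have hb' : b = 3 * c + 2 - β := by rw [hb, hc]; ring
  have hc2 : 2 < c := by linarith
  have hc0 : 0 < c := by linarith
  have hbN : β * N + 4 - b < 0 := by linarith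
  have hn0 : (0 : ℝ) < N + 1 := by positivity
  set M := powerMoment β b c (N + 1) with hM
  set Z := moment β b c fun _ : Fin (N + 1) → ℝ => 1 with hZ
  have hM00 : M 0 0 = (N + 1) * Z := by
    simp [hM, hZ, powerMoment, moment, integral_const_mul]
  have hZ0 : 0 < Z := by
    have h : 0 < M 0 0 := powerMoment_zero_zero_pos hβ0 hc0 hbN
    rw [hM00] at h
    exact pos_of_mul_pos_right h hn0.le
  have hM01 : M 0 1 = (N + 1) * M 1 0 := by
    rw [hM, powerMoment_zero_succ]; push_cast; ring
  have hM02 : M 0 2 = (N + 1) * M 1 1 := by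
    rw [hM, powerMoment_zero_succ]; push_cast; ring
  have e₁ := powerMoment_loop_zero hβ1 hc0 hbN (r := 0) (by norm_num)
  have e₂ := powerMoment_loop_zero hβ1 hc0 hbN (r := 1) (by norm_num)
  have e₃ := powerMoment_loop_zero hβ1 hc0 hbN (r := 2) (by norm_num)
  have e₄ := powerMoment_loop_one hβ1 hc0 hbN (r := 0) (by norm_num)
  have e₅ := powerMoment_loop_one hβ1 hc0 hbN (r := 1) (by norm_num)
  have e₆ := powerMoment_loop_two hβ1 hc0 hbN
  simp only [← hM, hM00, hM01, hM02, Nat.cast_zero, Nat.cast_one, Nat.cast_ofNat, zero_mul, one_mul,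
    Nat.reduceAdd, Nat.reduceSub, zero_add] at e₁ e₂ e₃ e₄ e₅ e₆
  have hs2 : 2 - b + β * N = -c := by rw [hb', hcN]; ring
  have hs3 : 3 - b + β * (N - 1 / 2) = 1 - c - β / 2 := by linarith
  have hs4 : 4 - b + β * (N - 1) = 2 - c - β := by linarith
  rw [hs2] at e₁ e₂ e₃
  rw [hs3] at e₄ e₅
  rw [hs4] at e₆
  obtain ⟨hA₁, hA⟩ := third_central_of_loop_equations (n := N + 1) (Z := Z) (A₁ := M 1 0)
    (A₂ := M 1 1) (A₃ := M 1 2) (C := M 2 0) (D := M 2 1) (G := M 3 0) hβ1 hcN hc2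
    (by linarith) (by linarith) (by linarith) (by linarith) (by linarith) (by linarith)
  have hmean : wdE β b (N + 1) (fun τ' => (1 / ((N + 1 : ℕ) : ℝ)) * ∑ j, τ' j) = 1 := by
    have h : moment β b c (fun τ : Fin (N + 1) → ℝ => (1 / ((N + 1 : ℕ) : ℝ)) * ∑ j, τ j)
        = (1 / ((N + 1 : ℕ) : ℝ)) * M 1 0 := by
      simp [hM, powerMoment, moment, mul_assoc, integral_const_mul]
    rw [wdE_eq_moment_div, ← hc, ← hZ, h, hA₁]
    push_cast
    field_simp
  have hthird : moment β b c
      (fun τ : Fin (N + 1) → ℝ => ((1 / ((N + 1 : ℕ) : ℝ)) * ∑ j, τ j - 1) ^ 3)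
      = (1 / (N + 1) ^ 3) * M 1 2 + (-3 / (N + 1) ^ 2) * M 1 1 + 3 / (N + 1) * M 1 0
        + (-1 / (N + 1)) * M 0 0 := by
    have h := moment_linear_combination (b := b) hβ0 hc0 hbN
      ![1 / ((N : ℝ) + 1) ^ 3, -3 / ((N : ℝ) + 1) ^ 2, 3 / ((N : ℝ) + 1), -1 / ((N : ℝ) + 1)]
      ![1, 1, 1, 0] ![2, 1, 0, 0] (by simp [Fin.forall_fin_succ])
    simp only [Fin.sum_univ_four, ← hM] at h
    refine Eq.trans (congrArg _ (funext fun τ => ?_)) h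
    simp
    field_simp
    ring
  rw [hmean, wdE_eq_moment_div, ← hc, ← hZ, hthird, hM00, hA₁]
  have hden1 : 0 < c - 1 := by linarith
  have hden2 : 0 < c - 2 := by linarith
  have hK : (1 / (N + 1 : ℝ) ^ 3) * M 1 2 + (-3 / (N + 1) ^ 2) * M 1 1
      + 3 / (N + 1) * ((N + 1) * Z) + (-1 / (N + 1)) * ((N + 1) * Z)
      = (M 1 2 - 3 * (N + 1) * M 1 1 + 2 * (N + 1) ^ 3 * Z) / (N + 1) ^ 3 := by
    field_simp
    ring
  have hden : ((N + 1 : ℕ) + 1 : ℝ) * ((N + 1 : ℕ) + 2) * ((N + 1 : ℕ) * β - 2)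
      * ((N + 1 : ℕ) * β - 4) = 4 * ((N + 1 + 1) * (N + 1 + 2) * (c - 1) * (c - 2)) := by
    rw [hcN]
    push_cast
    ring
  rw [hK, hden, div_div, div_eq_div_iff (by positivity) (by positivity)]
  linear_combination 4 * hA
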